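/- Let 𝒜 be a unital C*-algebra, K and H complex Hilbert spaces, (S, π) a concrete operator 𝒜-system in B(K), and ρ: 𝒜 → B(H) a unital *-homomorphism admitting a cyclic vector, i.e. a vector ξ ∈ H such that {ρ(a)ξ : a ∈ 𝒜} is dense in H. Suppose Φ: S → B(H) is a linear map such that Φ(π(a) x π(b)) = ρ(a) Φ(x) ρ(b) for all x ∈ S and all a, b ∈ 𝒜. If ‖Φ(x)‖ ≤ ‖x‖ for all x ∈ S, then Φ is completely contractive: for every n ∈ ℕ and every X = (x_{ij})_{i,j=1}^n ∈ M_n(S), the norm of (Φ(x_{ij}))_{i,j} in B(H^n) is at most the norm of X in B(K^n). -/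

import Mathlib

open Matrix
open scoped InnerProductSpace

noncomputable section

/-- The bounded operator on the Hilbert space direct sum `H^n = PiLp 2 (fun _ : Fin n => H)`
induced by an `n × n` matrix of bounded operators on `H`. -/
def matOp {H : Type*} [NormedAddCommGroup H] [InnerProductSpace ℂ H]
    {n : ℕ} (T : Matrix (Fin n) (Fin n) (H →L[ℂ] H)) :
    (PiLp 2 fun _ : Fin n => H) →L[ℂ] (PiLp 2 fun _ : Fin n => H) :=
  ((PiLp.continuousLinearEquiv 2 ℂ fun _ : Fin n => H).symm.toContinuousLinearMap).comp
    ((ContinuousLinearMap.pi fun i =>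
        ∑ j, (T i j).comp (ContinuousLinearMap.proj j)).comp
      (PiLp.continuousLinearEquiv 2 ℂ fun _ : Fin n => H).toContinuousLinearMap)

theorem matOp_apply' {H : Type*} [NormedAddCommGroup H] [InnerProductSpace ℂ H]
    {n : ℕ} (T : Matrix (Fin n) (Fin n) (H →L[ℂ] H)) (h : PiLp 2 fun _ : Fin n => H) (i : Fin n) :
    matOp T h i = ∑ j, T i j (h j) := by
  simp [matOp]

theorem norm_le_of_inner_le' {H : Type*} [NormedAddCommGroup H] [InnerProductSpace ℂ H]
    (T : H →L[ℂ] H) (M : ℝ) (hM : 0 ≤ M)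
    (h : ∀ x y : H, ‖⟪y, T x⟫_ℂ‖ ≤ M * ‖x‖ * ‖y‖) : ‖T‖ ≤ M := by
  refine T.opNorm_le_bound hM fun x => ?_
  have h1 := h x (T x)
  rw [inner_self_eq_norm_sq_to_K] at h1
  simp only [Complex.coe_algebraMap, norm_pow, Complex.norm_real, norm_norm] at h1
  by_cases h0 : ‖T x‖ = 0
  · rw [h0]; positivity
  · have : 0 < ‖T x‖ := lt_of_le_of_ne (norm_nonneg _) (Ne.symm h0)
    have h2 : ‖T x‖ * ‖T x‖ ≤ (M * ‖x‖) * ‖T x‖ := by simpa [sq] using h1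
    exact le_of_mul_le_mul_right h2 this

theorem exists_sqrt' {A : Type*} [CStarAlgebra A] {n : ℕ} (a : Fin n → A) (ε : ℝ) (hε : 0 < ε) :
    ∃ c d : A, star c = c ∧ c * c = ∑ j, star (a j) * a j + (ε : ℂ) • (1 : A) ∧
      c * d = 1 ∧ d * c = 1 := by
  let _ : PartialOrder A := CStarAlgebra.spectralOrder A
  have : StarOrderedRing A := CStarAlgebra.spectralOrderedRing A
  set q : A := ∑ j, star (a j) * a j with hq
  have hq0 : 0 ≤ q := Finset.sum_nonneg fun j _ => star_mul_self_nonneg _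
  have he : (ε : ℂ) • (1 : A) = algebraMap ℝ A ε := by
    rw [Algebra.algebraMap_eq_smul_one]; exact (RCLike.real_smul_eq_coe_smul (K := ℂ) ε (1 : A)).symm
  have hle : algebraMap ℝ A ε ≤ q + algebraMap ℝ A ε := le_add_of_nonneg_left hq0
  have he0 : (0 : A) ≤ algebraMap ℝ A ε := algebraMap_nonneg A hε.le
  have hp0 : 0 ≤ q + algebraMap ℝ A ε := he0.trans hle
  have hu : IsUnit (q + algebraMap ℝ A ε) :=
    CStarAlgebra.isUnit_of_le _ hle ((IsStrictlyPositive.iff_of_unital).2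
      ⟨he0, (isUnit_iff_ne_zero.2 hε.ne').map (algebraMap ℝ A)⟩)
  have hs := CFC.sqrt_mul_sqrt_self (q + algebraMap ℝ A ε) hp0
  have hcu : IsUnit (CFC.sqrt (q + algebraMap ℝ A ε)) := by
    rw [CFC.isUnit_sqrt_iff _ hp0]; exact hu
  obtain ⟨u, hu'⟩ := hcu
  refine ⟨CFC.sqrt (q + algebraMap ℝ A ε), ↑u⁻¹, ?_, ?_, ?_, ?_⟩
  · exact (IsSelfAdjoint.of_nonneg (CFC.sqrt_nonneg _)).star_eq
  · rw [hs, he]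
  · rw [← hu']; simp
  · rw [← hu']; simp

theorem norm_sq_formula' {A : Type*} [CStarAlgebra A]
    {L : Type*} [NormedAddCommGroup L] [InnerProductSpace ℂ L] [CompleteSpace L]
    (σ : A →⋆ₐ[ℂ] (L →L[ℂ] L)) {n : ℕ} (a : Fin n → A) (ε : ℝ) (c : A) (hc : star c = c)
    (hcc : c * c = ∑ j, star (a j) * a j + (ε : ℂ) • (1 : A)) (k : L) :
    ‖σ c k‖ ^ 2 = ∑ j, ‖σ (a j) k‖ ^ 2 + ε * ‖k‖ ^ 2 := by
  have key : ∀ b : A, ((‖σ b k‖ ^ 2 : ℝ) : ℂ) = ⟪k, σ (star b * b) k⟫_ℂ := by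
    intro b
    rw [map_mul, map_star, mul_apply_eq_comp, ContinuousLinearMap.star_eq_adjoint,
      ContinuousLinearMap.adjoint_inner_right, inner_self_eq_norm_sq_to_K]
    simp
  have h1 := key c
  rw [hc, hcc, map_add, map_sum, map_smul, map_one, ContinuousLinearMap.add_apply,
    ContinuousLinearMap.sum_apply, inner_add_right, inner_sum] at h1
  simp only [← key] at h1
  rw [ContinuousLinearMap.smul_apply, one_apply_eq_self, inner_smul_right,
    inner_self_eq_norm_sq_to_K] at h1
  apply Complex.ofReal_injective
  rw [h1]
  simp

/-- the column operator is contractive -/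
theorem col_le' {A : Type*} [CStarAlgebra A]
    {L : Type*} [NormedAddCommGroup L] [InnerProductSpace ℂ L] [CompleteSpace L]
    (σ : A →⋆ₐ[ℂ] (L →L[ℂ] L)) {n : ℕ} (a : Fin n → A) (ε : ℝ) (hε : 0 < ε) (c d : A)
    (hc : star c = c)
    (hcc : c * c = ∑ j, star (a j) * a j + (ε : ℂ) • (1 : A)) (hcd : c * d = 1) (k : L) :
    ‖(WithLp.toLp 2 (fun j => σ (a j * d) k) : PiLp 2 fun _ : Fin n => L)‖ ≤ ‖k‖ := by
  have h1 := norm_sq_formula' σ a ε c hc hcc (σ d k)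
  rw [← mul_apply_eq_comp, ← map_mul, hcd, map_one,
    one_apply_eq_self] at h1
  rw [← sq_le_sq₀ (norm_nonneg _) (norm_nonneg _), PiLp.norm_sq_eq_of_L2, h1]
  simp only [map_mul, mul_apply_eq_comp]
  have : 0 ≤ ε * ‖σ d k‖ ^ 2 := by positivity
  linarith

theorem key_bound'
    {A : Type*} [CStarAlgebra A]
    {K H : Type*} [NormedAddCommGroup K] [InnerProductSpace ℂ K] [CompleteSpace K]
    [NormedAddCommGroup H] [InnerProductSpace ℂ H] [CompleteSpace H]
    (π : A →⋆ₐ[ℂ] (K →L[ℂ] K)) (S : Submodule ℂ (K →L[ℂ] K))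
    (hSmod : ∀ (a b : A), ∀ x ∈ S, π a * x * π b ∈ S)
    (ρ : A →⋆ₐ[ℂ] (H →L[ℂ] H)) (ξ : H)
    (Φ : S →ₗ[ℂ] (H →L[ℂ] H))
    (hΦmod : ∀ (a b : A) (x y : S), (y : K →L[ℂ] K) = π a * (x : K →L[ℂ] K) * π b →
      Φ y = ρ a * Φ x * ρ b)
    (hcontr : ∀ x : S, ‖Φ x‖ ≤ ‖(x : K →L[ℂ] K)‖)
    (n : ℕ) (X : Matrix (Fin n) (Fin n) S) (a b : Fin n → A) (ε : ℝ) (hε : 0 < ε) :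
    ‖⟪(WithLp.toLp 2 (fun i => ρ (b i) ξ) : PiLp 2 fun _ : Fin n => H),
      matOp (X.map fun x => Φ x) (WithLp.toLp 2 (fun i => ρ (a i) ξ))⟫_ℂ‖ ≤
    ‖matOp (X.map fun x => (x : K →L[ℂ] K))‖ *
      √(‖(WithLp.toLp 2 (fun i => ρ (a i) ξ) : PiLp 2 fun _ : Fin n => H)‖ ^ 2 + ε * ‖ξ‖ ^ 2) *
      √(‖(WithLp.toLp 2 (fun i => ρ (b i) ξ) : PiLp 2 fun _ : Fin n => H)‖ ^ 2 + ε * ‖ξ‖ ^ 2) := by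
  obtain ⟨c, c', hc, hcc, hc1, hc2⟩ := exists_sqrt' a ε hε
  obtain ⟨d, d', hd, hdd, hd1, hd2⟩ := exists_sqrt' b ε hε
  set M := ‖matOp (X.map fun x => (x : K →L[ℂ] K))‖ with hM
  rw [PiLp.norm_sq_eq_of_L2, PiLp.norm_sq_eq_of_L2]
  simp only []
  rw [← norm_sq_formula' ρ a ε c hc hcc ξ, ← norm_sq_formula' ρ b ε d hd hdd ξ,
    Real.sqrt_sq (norm_nonneg _), Real.sqrt_sq (norm_nonneg _)]
  let y : Fin n → Fin n → S := fun i j =>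
    ⟨π (star (b i * d')) * (X i j : K →L[ℂ] K) * π (a j * c'), hSmod _ _ _ (X i j).2⟩
  let z : S := ∑ i, ∑ j, y i j
  have hz : ‖(z : K →L[ℂ] K)‖ ≤ M := by
    refine norm_le_of_inner_le' _ _ (norm_nonneg _) fun k l => ?_
    have e : ⟪l, (z : K →L[ℂ] K) k⟫_ℂ =
        ⟪(WithLp.toLp 2 (fun i => π (b i * d') l) : PiLp 2 fun _ : Fin n => K),
        matOp (X.map fun x => (x : K →L[ℂ] K)) (WithLp.toLp 2 (fun i => π (a i * c') k))⟫_ℂ := by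
      rw [PiLp.inner_apply]
      simp only [matOp_apply', z, y, Submodule.coe_sum, ContinuousLinearMap.sum_apply, inner_sum,
        mul_apply_eq_comp, map_star, ContinuousLinearMap.star_eq_adjoint,
        ContinuousLinearMap.adjoint_inner_right, Matrix.map_apply]
    rw [e]
    refine (norm_inner_le_norm _ _).trans ?_
    rw [mul_comm]
    refine mul_le_mul ?_ (col_le' π b ε hε d d' hd hdd hd1 l) (norm_nonneg _) (by positivity)
    refine (ContinuousLinearMap.le_opNorm _ _).trans ?_
    exact mul_le_mul_of_nonneg_left (col_le' π a ε hε c c' hc hcc hc1 k) (norm_nonneg _)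
  have e : ⟪(WithLp.toLp 2 (fun i => ρ (b i) ξ) : PiLp 2 fun _ : Fin n => H),
      matOp (X.map fun x => Φ x) (WithLp.toLp 2 (fun i => ρ (a i) ξ))⟫_ℂ =
      ⟪ρ d ξ, Φ z (ρ c ξ)⟫_ℂ := by
    rw [PiLp.inner_apply]
    simp only [matOp_apply', z, map_sum, ContinuousLinearMap.sum_apply, inner_sum]
    refine Finset.sum_congr rfl fun i _ => Finset.sum_congr rfl fun j _ => ?_
    rw [hΦmod (star (b i * d')) (a j * c') (X i j) (y i j) rfl]
    simp only [mul_apply_eq_comp, map_star, ContinuousLinearMap.star_eq_adjoint,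
        ContinuousLinearMap.adjoint_inner_right, Matrix.map_apply]
    simp only [← mul_apply_eq_comp, ← map_mul, mul_assoc, hc2, hd2, mul_one]
  rw [e]
  refine (norm_inner_le_norm _ _).trans ?_
  rw [mul_comm]
  refine mul_le_mul_of_nonneg_right ?_ (norm_nonneg _)
  refine (ContinuousLinearMap.le_opNorm _ _).trans ?_
  exact mul_le_mul_of_nonneg_right ((hcontr z).trans hz) (norm_nonneg _)

/-- Theorem 4.6 (Smith's lemma, operator `𝒜`-system version): if `(S, π)` is a concrete
operator `𝒜`-system in `B(K)`, `ρ : 𝒜 → B(H)` is a unital *-homomorphism with a cyclic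
vector, and `Φ : S → B(H)` is a contractive linear map satisfying
`Φ(π(a) x π(b)) = ρ(a) Φ(x) ρ(b)`, then `Φ` is completely contractive. -/
theorem completelyContractive_of_contractive_bimodule_map
    {A : Type*} [CStarAlgebra A]
    {K H : Type*} [NormedAddCommGroup K] [InnerProductSpace ℂ K] [CompleteSpace K]
    [NormedAddCommGroup H] [InnerProductSpace ℂ H] [CompleteSpace H]
    (π : A →⋆ₐ[ℂ] (K →L[ℂ] K)) (S : Submodule ℂ (K →L[ℂ] K))
    (hone : (1 : K →L[ℂ] K) ∈ S)
    (hstar : ∀ x ∈ S, star x ∈ S)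
    (hSmod : ∀ (a b : A), ∀ x ∈ S, π a * x * π b ∈ S)
    (ρ : A →⋆ₐ[ℂ] (H →L[ℂ] H))
    (hcyclic : ∃ ξ : H, DenseRange fun a : A => ρ a ξ)
    (Φ : S →ₗ[ℂ] (H →L[ℂ] H))
    (hΦmod : ∀ (a b : A) (x y : S), (y : K →L[ℂ] K) = π a * (x : K →L[ℂ] K) * π b →
      Φ y = ρ a * Φ x * ρ b)
    (hcontr : ∀ x : S, ‖Φ x‖ ≤ ‖(x : K →L[ℂ] K)‖) :
    ∀ (n : ℕ) (X : Matrix (Fin n) (Fin n) S),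
      ‖matOp (X.map fun x => Φ x)‖ ≤ ‖matOp (X.map fun x => (x : K →L[ℂ] K))‖ := by
  intro n X
  obtain ⟨ξ, hξ⟩ := hcyclic
  have hd : DenseRange (fun a : Fin n → A =>
      (WithLp.toLp 2 (fun i => ρ (a i) ξ) : PiLp 2 fun _ : Fin n => H)) := by
    have h1 : DenseRange (Pi.map fun (_ : Fin n) (a : A) => ρ a ξ) := DenseRange.piMap fun _ => hξ
    exact ((PiLp.continuousLinearEquiv 2 ℂ fun _ : Fin n => H).symm.surjective.denseRange).comp h1
      (PiLp.continuousLinearEquiv 2 ℂ fun _ : Fin n => H).symm.continuous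
  refine norm_le_of_inner_le' _ _ (norm_nonneg _) fun x y => ?_
  refine DenseRange.induction_on₂ (p := fun x y => ‖⟪y, matOp (X.map fun x => Φ x) x⟫_ℂ‖ ≤
    ‖matOp (X.map fun x => (x : K →L[ℂ] K))‖ * ‖x‖ * ‖y‖) hd ?_ ?_ x y
  · exact isClosed_le (by fun_prop) (by fun_prop)
  · intro a b
    have hb := fun ε hε => key_bound' π S hSmod ρ ξ Φ hΦmod hcontr n X a b ε hε
    set u := (WithLp.toLp 2 (fun i => ρ (a i) ξ) : PiLp 2 fun _ : Fin n => H)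
    set v := (WithLp.toLp 2 (fun i => ρ (b i) ξ) : PiLp 2 fun _ : Fin n => H)
    have hcont : Continuous fun ε : ℝ => ‖matOp (X.map fun x => (x : K →L[ℂ] K))‖ *
      √(‖u‖ ^ 2 + ε * ‖ξ‖ ^ 2) * √(‖v‖ ^ 2 + ε * ‖ξ‖ ^ 2) := by fun_prop
    have ht := (hcont.tendsto 0).mono_left (nhdsWithin_le_nhds (s := Set.Ioi 0))
    simp only [zero_mul, add_zero, Real.sqrt_sq (norm_nonneg _)] at ht
    exact ge_of_tendsto ht (Filter.eventually_of_mem self_mem_nhdsWithin fun ε hε => hb ε hε)
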